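/- Let q be a prime power, let ω be a primitive element (multiplicative generator) of F_q^*, and suppose t_1,...,t_6 are six distinct elements of Z_{q-1} satisfying t_1 + t_6 = t_2 + t_5 = t_3 + t_4 (in Z_{q-1}). Then the polynomial f(x_1,...,x_6) = (x_1-x_4)(x_2-x_6)(x_3-x_5) - (x_2-x_4)(x_1-x_5)(x_3-x_6) vanishes at the point (ω^{t_1}, ω^{t_2}, ω^{t_3}, ω^{t_4}, ω^{t_5}, ω^{t_6}), i.e., f(ω^{t_1},...,ω^{t_6}) = 0. -/

import Mathlib

theorem aux_field_identity {F : Type} [Field F] (a b c d e f : F) (ha : a ≠ 0) (hb : b ≠ 0)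
    (hc : c ≠ 0) (h1 : a * f = b * e) (h2 : b * e = c * d) :
    (a - d) * (b - f) * (c - e) - (b - d) * (a - e) * (c - f) = 0 := by
  have hd : d = b * e / c := by field_simp; linear_combination -h2
  have hf : f = b * e / a := by field_simp; linear_combination h1
  subst hd hf
  field_simp
  ring

theorem aux_pow_val {F : Type} [Field F] (n : ℕ) (w : F) (hw : w ^ n = 1) [NeZero n]
    (a b : ZMod n) : w ^ a.val * w ^ b.val = w ^ (a + b).val := by
  rw [← pow_add, ZMod.val_add, ← pow_eq_pow_mod _ hw]

/-- let `ω` be a primitive element of `F_q^*` and `t₁, …, t₆` six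
distinct elements of `ℤ/(q-1)` with `t₁ + t₆ = t₂ + t₅ = t₃ + t₄`. Then the polynomial
`f(x₁,…,x₆) = (x₁-x₄)(x₂-x₆)(x₃-x₅) - (x₂-x₄)(x₁-x₅)(x₃-x₆)` vanishes at
`(ω^{t₁}, …, ω^{t₆})`. -/
theorem poly_vanishes_at_powers_of_primitive_element
    (q : ℕ) (hq : IsPrimePow q) (F : Type) [Field F] [Fintype F]
    (hF : Fintype.card F = q) (ω : F)
    (hω : ∀ x : F, x ≠ 0 → ∃ k : ℕ, ω ^ k = x)
    (t : Fin 6 → ZMod (q - 1)) (ht : Function.Injective t)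
    (h16_25 : t 0 + t 5 = t 1 + t 4) (h25_34 : t 1 + t 4 = t 2 + t 3) :
    (ω ^ (t 0).val - ω ^ (t 3).val) * (ω ^ (t 1).val - ω ^ (t 5).val) *
        (ω ^ (t 2).val - ω ^ (t 4).val) -
      (ω ^ (t 1).val - ω ^ (t 3).val) * (ω ^ (t 0).val - ω ^ (t 4).val) *
        (ω ^ (t 2).val - ω ^ (t 5).val) = 0 := by
  by_cases h0 : ω = 0
  · have h01 : ∀ x : F, x ≠ 0 → x = 1 := by
      intro x hx
      obtain ⟨k, hk⟩ := hω x hx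
      rcases Nat.eq_zero_or_pos k with rfl | hk'
      · simpa using hk.symm
      · rw [h0, zero_pow hk'.ne'] at hk
        exact absurd hk.symm hx
    have hle : Fintype.card F ≤ 2 := by
      classical
      have : (Finset.univ : Finset F) ⊆ {0, 1} := by
        intro x _
        by_cases hx : x = 0
        · simp [hx]
        · simp [h01 x hx]
      exact (Finset.card_le_card this).trans Finset.card_le_two
    have hgt : 1 < Fintype.card F := Fintype.one_lt_card
    obtain rfl : q = 2 := by omega
    have : t 0 = t 1 := Subsingleton.elim (α := ZMod 1) _ _
    exact absurd (ht this) (by decide)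
  · have hgt : 1 < Fintype.card F := Fintype.one_lt_card
    have : NeZero (q - 1) := ⟨by omega⟩
    have hw : ω ^ (q - 1) = 1 := by
      rw [← hF]; exact FiniteField.pow_card_sub_one_eq_one ω h0
    apply aux_field_identity
    · exact pow_ne_zero _ h0
    · exact pow_ne_zero _ h0
    · exact pow_ne_zero _ h0
    · rw [aux_pow_val _ _ hw, aux_pow_val _ _ hw, h16_25]
    · rw [aux_pow_val _ _ hw, aux_pow_val _ _ hw, h25_34]
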